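/- arXiv:2406.13871 — 3 statements merged into one kernel-verified Lean document; each statement's English description precedes it below -/
import Mathlib

section
/- Let f : ℝ → ℝ be a probability density on ℝ that is Lipschitz continuous, and assume f(x) ≤ 1 for all x. Then there exists a constant C ≥ 1 such that C · ∫_ℝ g(x) f(x) dx = 1; consequently the function x ↦ C · g(x) · f(x) is itself a probability density on ℝ (Proposition 1 of the paper). -/
open Real MeasureTheory

/-- Proposition 1: There is a constant `C ≥ 1` normalizing the
Gaussian-reweighted density so that `x ↦ C * g x * f x` is a probability density. -/
theorem gaussian_reweighted_is_density
    (μx μ σx σ : ℝ) (hσx : 0 < σx) (hσ : 0 < σ) (hσx1 : σx ≤ 1)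
    (g : ℝ → ℝ)
    (hg : ∀ x, g x = (1 / (σ * Real.sqrt (2 * π))) *
      Real.exp (-(((x - μx) / σx - μ) ^ 2) / (2 * σ ^ 2)))
    (f : ℝ → ℝ) (hf_meas : Measurable f) (hf_nonneg : ∀ x, 0 ≤ f x)
    (hf_int : ∫ x, f x = 1) (hf_lip : ∃ K : NNReal, LipschitzWith K f)
    (hf_le_one : ∀ x, f x ≤ 1) :
    ∃ C : ℝ, 1 ≤ C ∧ C * ∫ x, g x * f x = 1 ∧
      Measurable (fun x => C * (g x * f x)) ∧
      (∀ x, 0 ≤ C * (g x * f x)) ∧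
      ∫ x, C * (g x * f x) = 1 := by
  have hs : 0 < σ * Real.sqrt (2 * π) := by positivity
  have hgpos : ∀ x, 0 < g x := by
    intro x
    rw [hg]
    positivity
  have hfi : Integrable f := by
    by_contra h
    rw [integral_undef h] at hf_int
    exact zero_ne_one hf_int
  have hgc : Continuous g := by
    have : g = fun x => (1 / (σ * Real.sqrt (2 * π))) *
      Real.exp (-(((x - μx) / σx - μ) ^ 2) / (2 * σ ^ 2)) := funext hg
    rw [this]
    fun_prop
  -- compare `g` with a genuine Gaussian density
  let v : NNReal := ⟨(σ * σx) ^ 2, by positivity⟩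
  have hv : v ≠ 0 := by
    intro h
    have h2 : (v : ℝ) = 0 := by rw [h]; rfl
    have h3 : (σ * σx) ^ 2 = 0 := h2
    have : 0 < (σ * σx) ^ 2 := by positivity
    linarith
  have hgG : g = fun x => σx * ProbabilityTheory.gaussianPDFReal (μx + σx * μ) v x := by
    funext x
    have hvv : (v : ℝ) = (σ * σx) ^ 2 := rfl
    rw [hg, ProbabilityTheory.gaussianPDFReal, hvv]
    have h1 : Real.sqrt (2 * π * (σ * σx) ^ 2) = Real.sqrt (2 * π) * (σ * σx) := by
      rw [Real.sqrt_mul (by positivity), Real.sqrt_sq (by positivity)]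
    have h2 : -(((x - μx) / σx - μ) ^ 2) / (2 * σ ^ 2)
        = -(x - (μx + σx * μ)) ^ 2 / (2 * (σ * σx) ^ 2) := by
      field_simp
      ring
    rw [h1, h2]
    have h3 : Real.sqrt (2 * π) ≠ 0 := by positivity
    field_simp
  have hgi : Integrable g := by
    rw [hgG]
    exact (ProbabilityTheory.integrable_gaussianPDFReal _ _).const_mul _
  have hgint : ∫ x, g x = σx := by
    rw [hgG, integral_const_mul, ProbabilityTheory.integral_gaussianPDFReal_eq_one _ hv, mul_one]
  have hle : ∀ x, g x * f x ≤ g x := fun x =>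
    mul_le_of_le_one_right (hgpos x).le (hf_le_one x)
  have hnn : ∀ x, 0 ≤ g x * f x := fun x => mul_nonneg (hgpos x).le (hf_nonneg x)
  have hmeas : Measurable (fun x => g x * f x) := hgc.measurable.mul hf_meas
  have hgfi : Integrable (fun x => g x * f x) := by
    refine hgi.mono' hmeas.aestronglyMeasurable (Filter.Eventually.of_forall fun x => ?_)
    rw [Real.norm_of_nonneg (hnn x)]
    exact hle x
  have hI1 : ∫ x, g x * f x ≤ 1 :=
    (integral_mono hgfi hgi hle).trans (hgint.le.trans hσx1)
  have hI0 : 0 < ∫ x, g x * f x := by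
    rw [integral_pos_iff_support_of_nonneg hnn hgfi]
    have hsupp : Function.support (fun x => g x * f x) = Function.support f := by
      ext x
      simp [(hgpos x).ne']
    rw [hsupp, ← integral_pos_iff_support_of_nonneg hf_nonneg hfi, hf_int]
    exact one_pos
  have hC : (∫ x, g x * f x)⁻¹ * ∫ x, g x * f x = 1 := inv_mul_cancel₀ hI0.ne'
  refine ⟨(∫ x, g x * f x)⁻¹, (one_le_inv₀ hI0).2 hI1, hC, hmeas.const_mul _,
    fun x => mul_nonneg (inv_nonneg.2 hI0.le) (hnn x), ?_⟩
  rw [integral_const_mul]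
  exact hC
end

section
/- Let f : ℝ → ℝ be measurable with 0 ≤ f(x) ≤ e^{λx} for all x ≥ 0, and let C > 0 be a constant. Then ∫_0^∞ e^{λx} · C · g(x) · f(x) dx ≤ C · σ_x · e^{D}, where D = (A² − (μ_x + μσ_x)²)/(2σ²σ_x²) and A = μ_x + μσ_x + 2λσ²σ_x² (Theorem 1 of the paper, with the explicit constant C′ = C σ_x e^{D}). -/
open Real MeasureTheory

/-- Theorem 1 with explicit constant:
`∫_0^∞ e^{λx} C g x f x dx ≤ C σx e^D`. -/
theorem reweighted_halfline_integral_le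
    (μx μ lam σx σ : ℝ) (hσx : 0 < σx) (hσ : 0 < σ)
    (g : ℝ → ℝ)
    (hg : ∀ x, g x = (1 / (σ * Real.sqrt (2 * π))) *
      Real.exp (-(((x - μx) / σx - μ) ^ 2) / (2 * σ ^ 2)))
    (f : ℝ → ℝ) (hf_meas : Measurable f)
    (hf_nonneg : ∀ x, 0 ≤ x → 0 ≤ f x)
    (hf_le : ∀ x, 0 ≤ x → f x ≤ Real.exp (lam * x))
    (C : ℝ) (hC : 0 < C)
    (A D : ℝ)
    (hA : A = μx + μ * σx + 2 * lam * σ ^ 2 * σx ^ 2)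
    (hD : D = (A ^ 2 - (μx + μ * σx) ^ 2) / (2 * σ ^ 2 * σx ^ 2)) :
    ∫ x in Set.Ioi (0 : ℝ), Real.exp (lam * x) * C * g x * f x ≤
      C * σx * Real.exp D := by
  have hs : 0 < σ ^ 2 * σx ^ 2 := by positivity
  obtain ⟨v, hv⟩ : ∃ v : NNReal, (v : ℝ) = σ ^ 2 * σx ^ 2 := ⟨⟨_, hs.le⟩, rfl⟩
  have hv0 : v ≠ 0 := by
    intro h
    rw [h] at hv
    simp only [NNReal.coe_zero] at hv
    linarith
  have key : ∀ x, Real.exp (lam * x) * C * g x * Real.exp (lam * x) =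
      (C * σx * Real.exp D) * ProbabilityTheory.gaussianPDFReal A v x := by
    intro x
    have hsq : Real.sqrt (2 * π * v) = σ * σx * Real.sqrt (2 * π) := by
      rw [hv, show 2 * π * (σ ^ 2 * σx ^ 2) = (σ * σx) ^ 2 * (2 * π) by ring,
        Real.sqrt_mul (by positivity), Real.sqrt_sq (by positivity)]
    have hpi : 0 < Real.sqrt (2 * π) := by positivity
    have hexp : Real.exp (lam * x) * Real.exp (lam * x) *
        Real.exp (-(((x - μx) / σx - μ) ^ 2) / (2 * σ ^ 2)) =
        Real.exp D * Real.exp (-(x - A) ^ 2 / (2 * v)) := by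
      rw [← Real.exp_add, ← Real.exp_add, ← Real.exp_add, hv, hD, hA]
      congr 1
      field_simp
      ring
    rw [hg, ProbabilityTheory.gaussianPDFReal, hsq]
    calc _ = C * (1 / (σ * Real.sqrt (2 * π))) * (Real.exp (lam * x) * Real.exp (lam * x) *
        Real.exp (-(((x - μx) / σx - μ) ^ 2) / (2 * σ ^ 2))) := by ring
      _ = C * (1 / (σ * Real.sqrt (2 * π))) *
        (Real.exp D * Real.exp (-(x - A) ^ 2 / (2 * v))) := by rw [hexp]
      _ = _ := by
        generalize Real.exp (-(x - A) ^ 2 / (2 * v)) = E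
        field_simp
  have hint := (ProbabilityTheory.integrable_gaussianPDFReal A v).const_mul (C * σx * Real.exp D)
  have hgn : ∀ x, 0 ≤ g x := fun x => by rw [hg]; positivity
  calc _ ≤ ∫ x in Set.Ioi (0 : ℝ),
        (C * σx * Real.exp D) * ProbabilityTheory.gaussianPDFReal A v x := by
        apply integral_mono_of_nonneg
        · filter_upwards [ae_restrict_mem measurableSet_Ioi] with x hx
          have h1 := hf_nonneg x (le_of_lt hx)
          have h2 := hgn x
          simp only [Pi.zero_apply]
          positivity
        · exact hint.restrict
        · filter_upwards [ae_restrict_mem measurableSet_Ioi] with x hx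
          rw [← key]
          have h2 := hgn x
          exact mul_le_mul_of_nonneg_left (hf_le x (le_of_lt hx)) (by positivity)
    _ ≤ ∫ x, (C * σx * Real.exp D) * ProbabilityTheory.gaussianPDFReal A v x := by
        apply setIntegral_le_integral hint
        filter_upwards with x
        have := ProbabilityTheory.gaussianPDFReal_nonneg A v x
        simp only [Pi.zero_apply]
        positivity
    _ = _ := by
        rw [integral_const_mul, ProbabilityTheory.integral_gaussianPDFReal_eq_one A hv0, mul_one]
end

section
/- Let f : ℝ → ℝ be a probability density on ℝ that is Lipschitz continuous and satisfies f(x) ≤ 1 for all x, and let C = 1 / ∫_ℝ g(x) f(x) dx be the normalizing constant from Proposition 1 (which exists and is finite). Then the normalized reweighted density h(x) = C · g(x) · f(x) satisfies, for every λ > 0, ∫_0^∞ e^{λx} h(x) dx < ∞; i.e. the scaled weighted loss distribution with density h is not heavy-tailed (right). -/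
open Real MeasureTheory

/-- The normalized reweighted density `h = C · g · f`, with
`C = 1 / ∫ g f`, is not heavy-tailed (right). -/
theorem normalized_reweighted_not_heavy_tailed
    (μx μ σx σ : ℝ) (hσx : 0 < σx) (hσ : 0 < σ)
    (g : ℝ → ℝ)
    (hg : ∀ x, g x = (1 / (σ * Real.sqrt (2 * π))) *
      Real.exp (-(((x - μx) / σx - μ) ^ 2) / (2 * σ ^ 2)))
    (f : ℝ → ℝ) (hf_meas : Measurable f) (hf_nonneg : ∀ x, 0 ≤ f x)
    (hf_int : ∫ x, f x = 1) (hf_lip : ∃ K : NNReal, LipschitzWith K f)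
    (hf_le_one : ∀ x, f x ≤ 1)
    (C : ℝ) (hC : C = 1 / ∫ x, g x * f x)
    (h : ℝ → ℝ) (hh : ∀ x, h x = C * g x * f x) :
    ∀ lam : ℝ, 0 < lam →
      ∫⁻ x in Set.Ioi (0 : ℝ), ENNReal.ofReal (Real.exp (lam * x) * h x) < ⊤ := by
  intro lam hlam
  have hfi : Integrable f := by
    by_contra hn
    rw [integral_undef hn] at hf_int
    exact zero_ne_one hf_int
  have hg0 : ∀ x, 0 ≤ g x := fun x => by rw [hg]; positivity
  have hC0 : 0 ≤ C := by
    rw [hC]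
    exact one_div_nonneg.mpr (integral_nonneg fun x => mul_nonneg (hg0 x) (hf_nonneg x))
  set M : ℝ := C * (1 / (σ * Real.sqrt (2 * π))) *
    Real.exp (lam * (μx + σx * μ) + lam ^ 2 * σx ^ 2 * σ ^ 2 / 2) with hM
  have key : ∀ x, Real.exp (lam * x) * h x ≤ M * f x := by
    intro x
    have hexp : lam * x + -(((x - μx) / σx - μ) ^ 2) / (2 * σ ^ 2) ≤
        lam * (μx + σx * μ) + lam ^ 2 * σx ^ 2 * σ ^ 2 / 2 := by
      obtain ⟨t, ht⟩ : ∃ t, t = (x - μx) / σx - μ := ⟨_, rfl⟩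
      have hx : x = μx + σx * (t + μ) := by
        rw [ht]; field_simp; ring
      rw [← ht, hx]
      have hsq : lam * (μx + σx * μ) + lam ^ 2 * σx ^ 2 * σ ^ 2 / 2 -
          (lam * (μx + σx * (t + μ)) + -(t ^ 2) / (2 * σ ^ 2)) =
          (t / σ - lam * σx * σ) ^ 2 / 2 := by
        field_simp; ring
      have : 0 ≤ (t / σ - lam * σx * σ) ^ 2 / 2 := by positivity
      linarith
    have heq : Real.exp (lam * x) * h x = C * (1 / (σ * Real.sqrt (2 * π))) *
        Real.exp (lam * x + -(((x - μx) / σx - μ) ^ 2) / (2 * σ ^ 2)) * f x := by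
      rw [hh, hg, Real.exp_add]; ring
    rw [heq, hM]
    have h1 := Real.exp_le_exp.mpr hexp
    have h2 : 0 ≤ C * (1 / (σ * Real.sqrt (2 * π))) := by positivity
    exact mul_le_mul_of_nonneg_right (mul_le_mul_of_nonneg_left h1 h2) (hf_nonneg x)
  have hMi : Integrable (fun x => M * f x) := hfi.const_mul M
  calc ∫⁻ x in Set.Ioi (0 : ℝ), ENNReal.ofReal (Real.exp (lam * x) * h x)
      ≤ ∫⁻ x in Set.Ioi (0 : ℝ), ENNReal.ofReal (M * f x) :=
        lintegral_mono fun x => ENNReal.ofReal_le_ofReal (key x)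
    _ ≤ ∫⁻ x, ENNReal.ofReal (M * f x) := setLIntegral_le_lintegral _ _
    _ < ⊤ := hMi.lintegral_lt_top
end
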